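/- Let q₀ > 1 and let 1 < q₁ ≤ 𝒦(q₀). Then dim_H 𝒰_{q₀,q₁} = 0. -/

import Mathlib

open Filter Topology

/-- The base corresponding to a digit: `q0` for digit `0` (`false`), `q1` for digit `1` (`true`). -/
noncomputable def qb (q0 q1 : ℝ) (d : Bool) : ℝ := if d then q1 else q0

/-- `piE q0 q1 i = Σ_{k=1}^∞ i_k / (q_{i_1} ⋯ q_{i_k})`, with 0-based indexing. -/
noncomputable def piE (q0 q1 : ℝ) (i : ℕ → Bool) : ℝ :=
  ∑' k : ℕ, (if i k then (1 : ℝ) else 0) / ∏ j ∈ Finset.range (k + 1), qb q0 q1 (i j)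

/-- Strict lexicographic order `≺` on binary sequences. -/
def lexLt (u v : ℕ → Bool) : Prop := ∃ n : ℕ, (∀ m, m < n → u m = v m) ∧ u n < v n

/-- Non-strict lexicographic order `⪯`. -/
def lexLe (u v : ℕ → Bool) : Prop := lexLt u v ∨ u = v

/-- The tail `i_{n+1} i_{n+2} ⋯` of a sequence (0-based: drop the first `n` entries). -/
def shiftTail (i : ℕ → Bool) (n : ℕ) : ℕ → Bool := fun k => i (n + k)

/-- `Omega a b` : sequences none of whose tails lies in the open lexicographic interval `]a,b[`. -/
def Omega (a b : ℕ → Bool) : Set (ℕ → Bool) :=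
  {i | ∀ n : ℕ, ¬ (lexLt a (shiftTail i n) ∧ lexLt (shiftTail i n) b)}

/-- `(a,b) ∈ W` : `a` starts with digit 0, `b` starts with digit 1, and `a, b ∈ Ω_{a,b}`. -/
def memW (a b : ℕ → Bool) : Prop :=
  a 0 = false ∧ b 0 = true ∧ a ∈ Omega a b ∧ b ∈ Omega a b

/-- The set `L_{a,b,n}` of length-`n` prefixes of elements of `Ω_{a,b}`, as a finset. -/
noncomputable def Lwords (a b : ℕ → Bool) (n : ℕ) : Finset (Fin n → Bool) :=
  Set.Finite.toFinset
    (Set.toFinite {w : Fin n → Bool | ∃ i ∈ Omega a b, ∀ k : Fin n, i k.1 = w k})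

/-- Topological entropy `h(Ω_{a,b}) = lim_{n→∞} (1/n) log #L_{a,b,n}`; the limit exists by
subadditivity, hence it coincides with the `limsup` used here. -/
noncomputable def entropy (a b : ℕ → Bool) : ℝ :=
  Filter.limsup (fun n : ℕ => Real.log ((Lwords a b n).card) / n) Filter.atTop

/-- The univoque set `𝒰_{q₀,q₁}` of reals with exactly one `(q₀,q₁)`-expansion. -/
def univoque (q0 q1 : ℝ) : Set ℝ := {x | ∃! i : ℕ → Bool, piE q0 q1 i = x}

/-- The generalized Komornik–Loreti constant
`𝒦(q₀) = inf {q₁ > 1 : 𝒰_{q₀,q₁} is uncountable}`. -/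
noncomputable def Kconst (q0 : ℝ) : ℝ := sInf {q1 : ℝ | 1 < q1 ∧ ¬ (univoque q0 q1).Countable}


namespace DB

/-- Inverse branch associated with a digit. -/
noncomputable def fd (q0 q1 : ℝ) (c : Bool) (x : ℝ) : ℝ :=
  (x + if c then 1 else 0) / qb q0 q1 c

/-- Inverse branch associated with a word. -/
noncomputable def fw (q0 q1 : ℝ) : List Bool → ℝ → ℝ
  | [], x => x
  | c :: w, x => fd q0 q1 c (fw q0 q1 w x)

/-- Prepend a digit. -/
def scons (c : Bool) (i : ℕ → Bool) : ℕ → Bool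
  | 0 => c
  | n + 1 => i n

/-- Prepend a word. -/
def app : List Bool → (ℕ → Bool) → (ℕ → Bool)
  | [], i => i
  | c :: w, i => scons c (app w i)

/-- Drop first digit. -/
def sh (i : ℕ → Bool) : ℕ → Bool := fun n => i (n + 1)

lemma scons_sh (i : ℕ → Bool) : scons (i 0) (sh i) = i := by
  funext n; cases n <;> rfl

lemma sh_scons (c : Bool) (i : ℕ → Bool) : sh (scons c i) = i := rfl

lemma qb_gt {q0 q1 : ℝ} (h0 : 1 < q0) (h1 : 1 < q1) (c : Bool) : 1 < qb q0 q1 c := by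
  cases c <;> simpa [qb]

lemma exists_rho {q0 q1 : ℝ} (h0 : 1 < q0) (h1 : 1 < q1) :
    ∃ ρ : ℝ, 0 < ρ ∧ ρ < 1 ∧ ∀ c, (qb q0 q1 c)⁻¹ ≤ ρ := by
  refine ⟨max q0⁻¹ q1⁻¹, by positivity, max_lt (inv_lt_one_of_one_lt₀ h0)
    (inv_lt_one_of_one_lt₀ h1), ?_⟩
  intro c; cases c <;> simp [qb]

lemma term_bound {q0 q1 : ℝ} (h0 : 1 < q0) (h1 : 1 < q1) {ρ : ℝ}
    (hρ : ∀ c, (qb q0 q1 c)⁻¹ ≤ ρ) (i : ℕ → Bool) (k : ℕ) :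
    0 ≤ (if i k then (1 : ℝ) else 0) / ∏ j ∈ Finset.range (k + 1), qb q0 q1 (i j) ∧
    (if i k then (1 : ℝ) else 0) / ∏ j ∈ Finset.range (k + 1), qb q0 q1 (i j) ≤ ρ ^ (k + 1) := by
  have hp : 0 < ∏ j ∈ Finset.range (k + 1), qb q0 q1 (i j) :=
    Finset.prod_pos fun j _ => by linarith [qb_gt h0 h1 (i j)]
  constructor
  · split_ifs <;> positivity
  · calc _ ≤ (∏ j ∈ Finset.range (k + 1), qb q0 q1 (i j))⁻¹ := by
          rw [div_eq_mul_inv]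
          have : 0 ≤ (∏ j ∈ Finset.range (k + 1), qb q0 q1 (i j))⁻¹ := by positivity
          split_ifs <;> simp [this]
      _ = ∏ j ∈ Finset.range (k + 1), (qb q0 q1 (i j))⁻¹ := by rw [Finset.prod_inv_distrib]
      _ ≤ ∏ j ∈ Finset.range (k + 1), ρ := by
          apply Finset.prod_le_prod
          · intro j _; have := qb_gt h0 h1 (i j); positivity
          · intro j _; exact hρ _
      _ = _ := by simp

lemma summ {q0 q1 : ℝ} (h0 : 1 < q0) (h1 : 1 < q1) (i : ℕ → Bool) :
    Summable fun k : ℕ =>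
      (if i k then (1 : ℝ) else 0) / ∏ j ∈ Finset.range (k + 1), qb q0 q1 (i j) := by
  obtain ⟨ρ, p, l, hρ⟩ := exists_rho h0 h1
  refine Summable.of_nonneg_of_le (fun k => (term_bound h0 h1 hρ i k).1)
    (fun k => (term_bound h0 h1 hρ i k).2) ?_
  exact (summable_nat_add_iff 1).2 (summable_geometric_of_lt_one p.le l)

lemma piE_nonneg {q0 q1 : ℝ} (h0 : 1 < q0) (h1 : 1 < q1) (i : ℕ → Bool) : 0 ≤ piE q0 q1 i := by
  obtain ⟨ρ, p, l, hρ⟩ := exists_rho h0 h1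
  exact tsum_nonneg fun k => (term_bound h0 h1 hρ i k).1

lemma piE_bdd {q0 q1 : ℝ} (h0 : 1 < q0) (h1 : 1 < q1) : ∃ C, 0 ≤ C ∧ ∀ i, piE q0 q1 i ≤ C := by
  obtain ⟨ρ, p, l, hρ⟩ := exists_rho h0 h1
  have hs : Summable fun k : ℕ => ρ ^ (k + 1) :=
    (summable_nat_add_iff 1).2 (summable_geometric_of_lt_one p.le l)
  refine ⟨∑' k : ℕ, ρ ^ (k + 1), tsum_nonneg fun k => by positivity, fun i => ?_⟩
  exact (summ h0 h1 i).tsum_le_tsum (fun k => (term_bound h0 h1 hρ i k).2) hs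

lemma piE_rec {q0 q1 : ℝ} (h0 : 1 < q0) (h1 : 1 < q1) (i : ℕ → Bool) :
    piE q0 q1 i = fd q0 q1 (i 0) (piE q0 q1 (sh i)) := by
  unfold piE fd
  rw [(summ h0 h1 i).tsum_eq_zero_add, add_div, add_comm, ← tsum_div_const]
  congr 1
  · apply tsum_congr
    intro k
    rw [Finset.prod_range_succ' _ (k + 1), div_div]
    rfl
  · simp

lemma piE_scons {q0 q1 : ℝ} (h0 : 1 < q0) (h1 : 1 < q1) (c : Bool) (i : ℕ → Bool) :
    piE q0 q1 (scons c i) = fd q0 q1 c (piE q0 q1 i) := piE_rec h0 h1 _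

lemma piE_app {q0 q1 : ℝ} (h0 : 1 < q0) (h1 : 1 < q1) (w : List Bool) (i : ℕ → Bool) :
    piE q0 q1 (app w i) = fw q0 q1 w (piE q0 q1 i) := by
  induction w with
  | nil => rfl
  | cons c w ih => rw [app, piE_scons h0 h1, ih, fw]

lemma fd_lt {q0 q1 : ℝ} (h0 : 1 < q0) (h1 : 1 < q1) (c : Bool) {x y : ℝ} (h : x < y) :
    fd q0 q1 c x < fd q0 q1 c y := by
  have := qb_gt h0 h1 c
  unfold fd; gcongr

lemma fd_sub {q0 q1 : ℝ} (c : Bool) (x y : ℝ) :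
    fd q0 q1 c x - fd q0 q1 c y = (qb q0 q1 c)⁻¹ * (x - y) := by
  unfold fd; ring

lemma fw_lt {q0 q1 : ℝ} (h0 : 1 < q0) (h1 : 1 < q1) (w : List Bool) {x y : ℝ} (h : x < y) :
    fw q0 q1 w x < fw q0 q1 w y := by
  induction w with
  | nil => exact h
  | cons c w ih => exact fd_lt h0 h1 c ih

lemma fw_le {q0 q1 : ℝ} (h0 : 1 < q0) (h1 : 1 < q1) (w : List Bool) {x y : ℝ} (h : x ≤ y) :
    fw q0 q1 w x ≤ fw q0 q1 w y := by
  rcases h.eq_or_lt with h | h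
  · rw [h]
  · exact (fw_lt h0 h1 w h).le

lemma fw_append {q0 q1 : ℝ} (u v : List Bool) (x : ℝ) :
    fw q0 q1 (u ++ v) x = fw q0 q1 u (fw q0 q1 v x) := by
  induction u with
  | nil => rfl
  | cons c w ih => simp [fw, ih]

lemma app_append (u v : List Bool) (i : ℕ → Bool) : app (u ++ v) i = app u (app v i) := by
  induction u with
  | nil => rfl
  | cons c w ih => simp [app, ih]

lemma fw_contr {q0 q1 : ℝ} (h0 : 1 < q0) (h1 : 1 < q1) {ρ : ℝ}
    (hρ : ∀ c, (qb q0 q1 c)⁻¹ ≤ ρ) (w : List Bool) (x y : ℝ) :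
    |fw q0 q1 w x - fw q0 q1 w y| ≤ ρ ^ w.length * |x - y| := by
  induction w with
  | nil => simp [fw]
  | cons c w ih =>
    have := qb_gt h0 h1 c
    have p : 0 ≤ (qb q0 q1 c)⁻¹ := by positivity
    have p' := p.trans (hρ c)
    rw [fw, fw, fd_sub, abs_mul, abs_of_nonneg p, List.length_cons, pow_succ', mul_assoc]
    gcongr
    exact hρ c

/-- Upper contraction principle. -/
lemma upper_of_self {q0 q1 : ℝ} (h0 : 1 < q0) (h1 : 1 < q1) (X : Set (ℕ → Bool)) (b : ℝ)
    (hX : ∀ i ∈ X, ∃ w : List Bool, w ≠ [] ∧ ∃ j ∈ X, i = app w j ∧ fw q0 q1 w b ≤ b) :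
    ∀ i ∈ X, piE q0 q1 i ≤ b := by
  obtain ⟨ρ, p, l, hρ⟩ := exists_rho h0 h1
  obtain ⟨C, hC, hb⟩ := piE_bdd h0 h1
  have key : ∀ k : ℕ, ∀ i ∈ X, piE q0 q1 i ≤ b + ρ ^ k * (C + |b|) := by
    intro k
    induction k with
    | zero => intro i _; have := hb i; have := neg_abs_le b; simp; linarith
    | succ k ih =>
      intro i hi
      obtain ⟨w, hw, j, hj, rfl, hf⟩ := hX i hi
      have h2 := ih j hj
      rw [piE_app h0 h1]
      have h3 := fw_le h0 h1 w h2
      have h4 := fw_contr h0 h1 hρ w (b + ρ ^ k * (C + |b|)) b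
      have h5 : 0 ≤ ρ ^ k * (C + |b|) := by positivity
      rw [add_sub_cancel_left, abs_of_nonneg h5] at h4
      have h6 : ρ ^ w.length ≤ ρ := by
        have : 0 < w.length := List.length_pos_iff.2 hw
        calc ρ ^ w.length ≤ ρ ^ 1 := pow_le_pow_of_le_one p.le l.le this
          _ = ρ := pow_one _
      have h7 := le_abs_self (fw q0 q1 w (b + ρ ^ k * (C + |b|)) - fw q0 q1 w b)
      have h8 := mul_le_mul_of_nonneg_right h6 h5
      rw [pow_succ']
      linarith
  intro i hi
  have ht : Tendsto (fun k : ℕ => b + ρ ^ k * (C + |b|)) atTop (𝓝 (b + 0 * (C + |b|))) :=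
    ((tendsto_pow_atTop_nhds_zero_of_lt_one p.le l).mul_const _).const_add _
  simpa using ge_of_tendsto' ht fun k => key k i hi

/-- Lower contraction principle. -/
lemma lower_of_self {q0 q1 : ℝ} (h0 : 1 < q0) (h1 : 1 < q1) (X : Set (ℕ → Bool)) (b : ℝ)
    (hX : ∀ i ∈ X, ∃ w : List Bool, w ≠ [] ∧ ∃ j ∈ X, i = app w j ∧ b ≤ fw q0 q1 w b) :
    ∀ i ∈ X, b ≤ piE q0 q1 i := by
  obtain ⟨ρ, p, l, hρ⟩ := exists_rho h0 h1
  have key : ∀ k : ℕ, ∀ i ∈ X, b - ρ ^ k * |b| ≤ piE q0 q1 i := by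
    intro k
    induction k with
    | zero => intro i _; have := piE_nonneg h0 h1 i; have := le_abs_self b; simp; linarith
    | succ k ih =>
      intro i hi
      obtain ⟨w, hw, j, hj, rfl, hf⟩ := hX i hi
      have h2 := ih j hj
      rw [piE_app h0 h1]
      have h3 := fw_le h0 h1 w h2
      have h4 := fw_contr h0 h1 hρ w b (b - ρ ^ k * |b|)
      have h5 : 0 ≤ ρ ^ k * |b| := by positivity
      rw [sub_sub_cancel, abs_of_nonneg h5] at h4
      have h6 : ρ ^ w.length ≤ ρ := by
        have : 0 < w.length := List.length_pos_iff.2 hw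
        calc ρ ^ w.length ≤ ρ ^ 1 := pow_le_pow_of_le_one p.le l.le this
          _ = ρ := pow_one _
      have h7 := le_abs_self (fw q0 q1 w b - fw q0 q1 w (b - ρ ^ k * |b|))
      have h8 := mul_le_mul_of_nonneg_right h6 h5
      rw [pow_succ']
      linarith
  intro i hi
  have ht : Tendsto (fun k : ℕ => b - ρ ^ k * |b|) atTop (𝓝 (b - 0 * |b|)) :=
    ((tendsto_pow_atTop_nhds_zero_of_lt_one p.le l).mul_const _).const_sub _
  simpa using le_of_tendsto' ht fun k => key k i hi

lemma piE_le {q0 q1 : ℝ} (h0 : 1 < q0) (h1 : 1 < q1) (i : ℕ → Bool) :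
    piE q0 q1 i ≤ 1 / (q1 - 1) := by
  refine upper_of_self h0 h1 Set.univ _ ?_ i trivial
  intro i _
  refine ⟨[i 0], by simp, sh i, trivial, (scons_sh i).symm, ?_⟩
  have h2 : 0 < q1 - 1 := by linarith
  have h3 : 0 < 1 / (q1 - 1) := by positivity
  cases i 0
  · simp only [fw, fd, qb]
    simp
    rw [← one_div]
    exact div_le_self h3.le h0.le
  · simp only [fw, fd, qb]
    simp only [if_true]
    rw [div_le_iff₀ (by linarith)]
    field_simp
    linarith

/-- A bounded sequence of reals following the inverse branches is the value of the digits. -/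
lemma eq_piE_of_orbit {q0 q1 : ℝ} (h0 : 1 < q0) (h1 : 1 < q1) (i : ℕ → Bool) (g : ℕ → ℝ) (C : ℝ)
    (hC : ∀ n, |g n| ≤ C) (hg : ∀ n, g n = fd q0 q1 (i n) (g (n + 1))) : g 0 = piE q0 q1 i := by
  obtain ⟨ρ, p, l, hρ⟩ := exists_rho h0 h1
  obtain ⟨C', hC', hb⟩ := piE_bdd h0 h1
  have key : ∀ k n : ℕ, |g n - piE q0 q1 (fun m => i (n + m))| ≤ ρ ^ k * (C + C') := by
    intro k
    induction k with
    | zero =>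
      intro n
      have a1 := hC n
      have a2 := hb (fun m => i (n + m))
      have a3 := piE_nonneg h0 h1 (fun m => i (n + m))
      rw [abs_le] at a1 ⊢
      constructor <;> simp <;> linarith
    | succ k ih =>
      intro n
      have e : sh (fun m => i (n + m)) = fun m => i (n + 1 + m) := by
        funext m; simp [sh]; congr 1; ring
      rw [hg n, piE_rec h0 h1, e]
      have := fw_contr h0 h1 hρ [i n] (g (n+1)) (piE q0 q1 fun m => i (n + 1 + m))
      simp only [fw, List.length_singleton, pow_one] at this
      refine this.trans ?_
      rw [pow_succ', mul_assoc]
      exact mul_le_mul_of_nonneg_left (ih (n+1)) p.le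
  have ht : Tendsto (fun k : ℕ => ρ ^ k * (C + C')) atTop (𝓝 (0 * (C + C'))) :=
    ((tendsto_pow_atTop_nhds_zero_of_lt_one p.le l).mul_const _)
  have := ge_of_tendsto' ht fun k => key k 0
  simp only [zero_mul, zero_add] at this
  linarith [abs_nonpos_iff.1 this]

/-- Left end of the switch region. -/
noncomputable def tt (q1 : ℝ) : ℝ := 1 / q1

/-- Right end of the switch region. -/
noncomputable def ss (q0 q1 : ℝ) : ℝ := 1 / (q0 * (q1 - 1))

/-- The value of the sequence lies strictly outside the switch region, on the correct side. -/
def sep (q0 q1 : ℝ) (i : ℕ → Bool) : Prop :=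
  (i 0 = false → piE q0 q1 i < tt q1) ∧ (i 0 = true → ss q0 q1 < piE q0 q1 i)

lemma piE_zero_le {q0 q1 : ℝ} (h0 : 1 < q0) (h1 : 1 < q1) (i : ℕ → Bool) (h : i 0 = false) :
    piE q0 q1 i ≤ ss q0 q1 := by
  rw [piE_rec h0 h1, h]
  have := piE_le h0 h1 (sh i)
  have h2 : 0 < q1 - 1 := by linarith
  simp only [fd, qb, ss]
  simp
  rw [div_le_iff₀ (by linarith)]
  refine this.trans (le_of_eq ?_)
  field_simp

lemma piE_one_ge {q0 q1 : ℝ} (h0 : 1 < q0) (h1 : 1 < q1) (i : ℕ → Bool) (h : i 0 = true) :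
    tt q1 ≤ piE q0 q1 i := by
  rw [piE_rec h0 h1, h]
  have := piE_nonneg h0 h1 (sh i)
  simp only [fd, qb, tt, if_true]
  gcongr
  linarith

lemma fd_inj {q0 q1 : ℝ} (h0 : 1 < q0) (h1 : 1 < q1) (c : Bool) {x y : ℝ}
    (h : fd q0 q1 c x = fd q0 q1 c y) : x = y := by
  rcases lt_trichotomy x y with h' | h' | h'
  · exact absurd h (fd_lt h0 h1 c h').ne
  · exact h'
  · exact absurd h (fd_lt h0 h1 c h').ne'

lemma unique_of_sep {q0 q1 : ℝ} (h0 : 1 < q0) (h1 : 1 < q1) (X : Set (ℕ → Bool))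
    (hsh : ∀ i ∈ X, sh i ∈ X) (hX : ∀ i ∈ X, sep q0 q1 i) :
    ∀ n : ℕ, ∀ i ∈ X, ∀ j, piE q0 q1 j = piE q0 q1 i → j n = i n := by
  have head : ∀ i ∈ X, ∀ j, piE q0 q1 j = piE q0 q1 i → j 0 = i 0 := by
    intro i hi j hj
    have hs := hX i hi
    cases hi0 : i 0 <;> cases hj0 : j 0
    · rfl
    · exact absurd (piE_one_ge h0 h1 j hj0) (by rw [hj]; exact not_le.2 (hs.1 hi0))
    · exact absurd (piE_zero_le h0 h1 j hj0) (by rw [hj]; exact not_le.2 (hs.2 hi0))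
    · rfl
  intro n
  induction n with
  | zero => exact head
  | succ n ih =>
    intro i hi j hj
    have e := head i hi j hj
    have : piE q0 q1 (sh j) = piE q0 q1 (sh i) := by
      rw [piE_rec h0 h1 j, piE_rec h0 h1 i, e] at hj
      exact fd_inj h0 h1 _ hj
    exact ih (sh i) (hsh i hi) (sh j) this

lemma mem_univoque_of_sep {q0 q1 : ℝ} (h0 : 1 < q0) (h1 : 1 < q1) (X : Set (ℕ → Bool))
    (hsh : ∀ i ∈ X, sh i ∈ X) (hX : ∀ i ∈ X, sep q0 q1 i) (i : ℕ → Bool) (hi : i ∈ X) :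
    piE q0 q1 i ∈ univoque q0 q1 :=
  ⟨i, rfl, fun j hj => funext fun n => unique_of_sep h0 h1 X hsh hX n i hi j hj⟩

lemma uncountable_of_sep {q0 q1 : ℝ} (h0 : 1 < q0) (h1 : 1 < q1) (X : Set (ℕ → Bool))
    (hsh : ∀ i ∈ X, sh i ∈ X) (hX : ∀ i ∈ X, sep q0 q1 i)
    (F : (ℕ → Bool) → (ℕ → Bool)) (hF : ∀ e, F e ∈ X) (hinj : Function.Injective F) :
    ¬ (univoque q0 q1).Countable := by
  intro hc
  have : Countable (univoque q0 q1) := hc.to_subtype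
  let G : (ℕ → Bool) → univoque q0 q1 :=
    fun e => ⟨piE q0 q1 (F e), mem_univoque_of_sep h0 h1 X hsh hX _ (hF e)⟩
  have hG : Function.Injective G := by
    intro e e' h
    apply hinj
    have h' : piE q0 q1 (F e) = piE q0 q1 (F e') := congrArg Subtype.val h
    exact funext fun n => unique_of_sep h0 h1 X hsh hX n _ (hF e') _ h'
  have hcc : Countable (ℕ → Bool) := hG.countable
  have : Uncountable (Set ℕ) := by
    rw [← not_countable_iff]
    intro h
    obtain ⟨f, hf⟩ := h.exists_injective_nat
    exact Function.cantor_injective f hf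
  have e : Function.Injective (fun (A : Set ℕ) (n : ℕ) => (open Classical in decide (n ∈ A))) := by
    intro A B h
    ext n
    have := congrFun h n
    simpa using this
  exact (not_countable_iff.2 this) e.countable

/-- Block concatenation. -/
def blk (w0 w1 : List Bool) (e : ℕ → Bool) (n : ℕ) : Bool :=
  (if e (n / w0.length) then w1 else w0).getD (n % w0.length) false

lemma app_lt (w : List Bool) (i : ℕ → Bool) (n : ℕ) (h : n < w.length) :
    app w i n = w.getD n false := by
  induction w generalizing n with
  | nil => simp at h
  | cons c w ih =>
    cases n with
    | zero => rfl
    | succ n =>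
      simp only [app, scons]
      rw [ih n (by simpa using h)]
      simp

lemma app_add (w : List Bool) (i : ℕ → Bool) (k : ℕ) : app w i (w.length + k) = i k := by
  induction w with
  | nil => simp [app]
  | cons c w ih =>
    rw [List.length_cons, show w.length + 1 + k = (w.length + k) + 1 by ring]
    exact ih

lemma blk_rec (w0 w1 : List Bool) (hl : w0.length = w1.length) (hp : 0 < w0.length)
    (e : ℕ → Bool) : blk w0 w1 e = app (if e 0 then w1 else w0) (blk w0 w1 (sh e)) := by
  have hl' : ∀ c : Bool, (if c then w1 else w0).length = w0.length := by
    intro c; cases c <;> simp [hl]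
  funext n
  rcases lt_or_ge n w0.length with h | h
  · rw [app_lt _ _ _ (by rw [hl']; exact h)]
    simp [blk, Nat.div_eq_of_lt h, Nat.mod_eq_of_lt h]
  · obtain ⟨k, rfl⟩ := Nat.exists_eq_add_of_le h
    have := app_add (if e 0 then w1 else w0) (blk w0 w1 (sh e)) k
    rw [hl'] at this
    rw [this]
    unfold blk
    rw [Nat.add_div_left _ hp, Nat.add_mod_left]
    rfl

lemma app_inj {w w' : List Bool} {i i' : ℕ → Bool} (hl : w.length = w'.length)
    (h : app w i = app w' i') : w = w' ∧ i = i' := by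
  induction w generalizing w' with
  | nil =>
    cases w' with
    | nil => exact ⟨rfl, h⟩
    | cons => simp at hl
  | cons c w ih =>
    cases w' with
    | nil => simp at hl
    | cons c' w' =>
      have a : c = c' := congrFun h 0
      have b : app w i = app w' i' := congrArg sh h
      obtain ⟨r1, r2⟩ := ih (by simpa using hl) b
      exact ⟨by rw [a, r1], r2⟩

lemma blk_inj (w0 w1 : List Bool) (hl : w0.length = w1.length) (hp : 0 < w0.length)
    (hne : w0 ≠ w1) : Function.Injective (blk w0 w1) := by
  have key : ∀ n : ℕ, ∀ e e', blk w0 w1 e = blk w0 w1 e' → e n = e' n := by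
    have step : ∀ e e', blk w0 w1 e = blk w0 w1 e' →
        e 0 = e' 0 ∧ blk w0 w1 (sh e) = blk w0 w1 (sh e') := by
      intro e e' h
      rw [blk_rec w0 w1 hl hp e, blk_rec w0 w1 hl hp e'] at h
      have hl' : ∀ c : Bool, (if c then w1 else w0).length = w0.length := by
        intro c; cases c <;> simp [hl]
      obtain ⟨r1, r2⟩ := app_inj (by rw [hl', hl']) h
      refine ⟨?_, r2⟩
      cases h1 : e 0 <;> cases h2 : e' 0 <;> simp [h1, h2] at r1 ⊢
      · exact hne r1
      · exact hne r1.symm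
    intro n
    induction n with
    | zero => intro e e' h; exact (step e e' h).1
    | succ n ih => intro e e' h; exact ih _ _ (step e e' h).2
  intro e e' h
  exact funext fun n => key n e e' h

/-- Horseshoe condition for a word. -/
def hs (q0 q1 a b : ℝ) (w : List Bool) : Prop :=
  a < fw q0 q1 w a ∧ fw q0 q1 w b < b ∧
  ∀ r ∈ w.tails, (r.head? = some false → fw q0 q1 r b < tt q1) ∧
    (r.head? = some true → ss q0 q1 < fw q0 q1 r a)

lemma horseshoe {q0 q1 : ℝ} (h0 : 1 < q0) (h1 : 1 < q1) (a b : ℝ) (w0 w1 : List Bool)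
    (hl : w0.length = w1.length) (hne : w0 ≠ w1) (hs0 : hs q0 q1 a b w0) (hs1 : hs q0 q1 a b w1) :
    ¬ (univoque q0 q1).Countable := by
  have hp : 0 < w0.length := by
    by_contra h
    have e : w0.length = 0 := by omega
    rw [e] at hl
    exact hne (by rw [List.length_eq_zero_iff.1 e, List.length_eq_zero_iff.1 hl.symm])
  have hsc : ∀ c : Bool, hs q0 q1 a b (if c then w1 else w0) := by
    intro c; cases c <;> simpa
  have hnil : ∀ c : Bool, (if c then w1 else w0) ≠ [] := by
    intro c; cases c
    · simpa using List.length_pos_iff.1 hp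
    · simpa using List.length_pos_iff.1 (hl ▸ hp)
  have hB : ∀ i ∈ Set.range (blk w0 w1), piE q0 q1 i ≤ b := by
    apply upper_of_self h0 h1
    rintro _ ⟨e, rfl⟩
    exact ⟨_, hnil (e 0), _, ⟨sh e, rfl⟩, blk_rec w0 w1 hl hp e, (hsc _).2.1.le⟩
  have hA : ∀ i ∈ Set.range (blk w0 w1), a ≤ piE q0 q1 i := by
    apply lower_of_self h0 h1
    rintro _ ⟨e, rfl⟩
    exact ⟨_, hnil (e 0), _, ⟨sh e, rfl⟩, blk_rec w0 w1 hl hp e, (hsc _).1.le⟩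
  let X : Set (ℕ → Bool) := {i | ∃ (c : Bool) (r : List Bool) (e : ℕ → Bool),
    r ≠ [] ∧ r <:+ (if c then w1 else w0) ∧ i = app r (blk w0 w1 e)}
  have hFX : ∀ e, blk w0 w1 e ∈ X := fun e =>
    ⟨e 0, _, sh e, hnil (e 0), List.suffix_rfl, blk_rec w0 w1 hl hp e⟩
  refine uncountable_of_sep h0 h1 X ?_ ?_ (blk w0 w1) hFX (blk_inj w0 w1 hl hp hne)
  · rintro _ ⟨c, r, e, hr, hsuf, rfl⟩
    match r, hr, hsuf with
    | d :: r, _, hsuf =>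
      change app r (blk w0 w1 e) ∈ X
      by_cases hr' : r = []
      · subst hr'; exact hFX e
      · exact ⟨c, r, e, hr', (List.suffix_cons d r).trans hsuf, rfl⟩
  · rintro _ ⟨c, r, e, hr, hsuf, rfl⟩
    have hh := (hsc c).2.2 r ((List.mem_tails _ _).2 hsuf)
    match r, hr, hh with
    | d :: r, _, hh =>
      have e0 : app (d :: r) (blk w0 w1 e) 0 = d := rfl
      refine ⟨fun hd => ?_, fun hd => ?_⟩
      · rw [e0] at hd
        rw [piE_app h0 h1]
        exact (fw_le h0 h1 _ (hB _ ⟨e, rfl⟩)).trans_lt (hh.1 (by simp [hd]))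
      · rw [e0] at hd
        rw [piE_app h0 h1]
        exact (hh.2 (by simp [hd])).trans_le (fw_le h0 h1 _ (hA _ ⟨e, rfl⟩))

lemma fw_cont_q {q0 q1 : ℝ} (h0 : 1 < q0) (h1 : 1 < q1) (w : List Bool) (x : ℝ) :
    ContinuousAt (fun q => fw q0 q w x) q1 := by
  induction w with
  | nil => exact continuousAt_const
  | cons c w ih =>
    simp only [fw, fd]
    apply ContinuousAt.div
    · exact ih.add continuousAt_const
    · cases c <;> simp only [qb]
      · exact continuousAt_const
      · exact continuousAt_id
    · linarith [qb_gt h0 h1 c]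

lemma fw_cont_x {q0 q1 : ℝ} (w : List Bool) : Continuous (fw q0 q1 w) := by
  induction w with
  | nil => exact continuous_id
  | cons c w ih =>
    change Continuous fun x => fd q0 q1 c (fw q0 q1 w x)
    unfold fd
    exact (ih.add continuous_const).div_const _

lemma hs_open {q0 q1 : ℝ} (h0 : 1 < q0) (h1 : 1 < q1) (a b : ℝ) (w : List Bool)
    (h : hs q0 q1 a b w) : ∀ᶠ q in 𝓝 q1, hs q0 q a b w := by
  have c1 : ContinuousAt tt q1 := by
    unfold tt
    exact continuousAt_const.div continuousAt_id (by simp; linarith)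
  have c2 : ContinuousAt (ss q0) q1 := by
    unfold ss
    refine continuousAt_const.div (by fun_prop) ?_
    have : 0 < q0 * (q1 - 1) := mul_pos (by linarith) (by linarith)
    exact this.ne'
  refine (continuousAt_const.eventually_lt (fw_cont_q h0 h1 w a) h.1).and
    (((fw_cont_q h0 h1 w b).eventually_lt continuousAt_const h.2.1).and ?_)
  have := (Filter.eventually_all_finset (l := 𝓝 q1) w.tails.toFinset
    (p := fun r q => (r.head? = some false → fw q0 q r b < tt q) ∧
    (r.head? = some true → ss q0 q < fw q0 q r a))).2 ?_
  · filter_upwards [this] with q hq r hr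
    exact hq r (List.mem_toFinset.2 hr)
  · intro r hr
    have hr := h.2.2 r (List.mem_toFinset.1 hr)
    apply Filter.Eventually.and
    · by_cases hd : r.head? = some false
      · filter_upwards [(fw_cont_q h0 h1 r b).eventually_lt c1 (hr.1 hd)] with q hq _ using hq
      · exact Eventually.of_forall fun q hq => absurd hq hd
    · by_cases hd : r.head? = some true
      · filter_upwards [c2.eventually_lt (fw_cont_q h0 h1 r a) (hr.2 hd)] with q hq _ using hq
      · exact Eventually.of_forall fun q hq => absurd hq hd

lemma horseshoe_below {q0 q1 : ℝ} (h0 : 1 < q0) (h1 : 1 < q1) (a b : ℝ) (w0 w1 : List Bool)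
    (hl : w0.length = w1.length) (hne : w0 ≠ w1) (hs0 : hs q0 q1 a b w0) (hs1 : hs q0 q1 a b w1) :
    ∃ q, 1 < q ∧ q < q1 ∧ ¬ (univoque q0 q).Countable := by
  have e : ∀ᶠ q in 𝓝 q1, 1 < q ∧ hs q0 q a b w0 ∧ hs q0 q a b w1 :=
    (lt_mem_nhds h1).and ((hs_open h0 h1 a b w0 hs0).and (hs_open h0 h1 a b w1 hs1))
  have e' : ∀ᶠ q in 𝓝[<] q1, (1 < q ∧ hs q0 q a b w0 ∧ hs q0 q a b w1) ∧ q < q1 :=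
    (e.filter_mono nhdsWithin_le_nhds).and self_mem_nhdsWithin
  obtain ⟨q, ⟨a1, a2, a3⟩, a4⟩ := e'.exists
  exact ⟨q, a1, a4, horseshoe h0 a1 a b w0 w1 hl hne a2 a3⟩

/-- Transition of follower intervals. -/
noncomputable def step (q0 q1 : ℝ) (d : ℝ × ℝ) : Bool → ℝ × ℝ
  | false => (q0 * d.1, q0 * min d.2 (tt q1))
  | true => (q1 * max d.1 (ss q0 q1) - 1, q1 * d.2 - 1)

/-- Admissibility of a digit. -/
def adm (q0 q1 : ℝ) (d : ℝ × ℝ) : Bool → Prop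
  | false => d.1 < tt q1
  | true => ss q0 q1 < d.2

/-- State after reading a word. -/
noncomputable def run (q0 q1 : ℝ) : ℝ × ℝ → List Bool → ℝ × ℝ
  | d, [] => d
  | d, c :: w => run q0 q1 (step q0 q1 d c) w

/-- Admissibility of a word. -/
def ok (q0 q1 : ℝ) : ℝ × ℝ → List Bool → Prop
  | _, [] => True
  | d, c :: w => adm q0 q1 d c ∧ ok q0 q1 (step q0 q1 d c) w

lemma run_append (q0 q1 : ℝ) (d : ℝ × ℝ) (u v : List Bool) :
    run q0 q1 d (u ++ v) = run q0 q1 (run q0 q1 d u) v := by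
  induction u generalizing d with
  | nil => rfl
  | cons c u ih => exact ih _

lemma ok_append (q0 q1 : ℝ) (d : ℝ × ℝ) (u v : List Bool) :
    ok q0 q1 d (u ++ v) ↔ ok q0 q1 d u ∧ ok q0 q1 (run q0 q1 d u) v := by
  induction u generalizing d with
  | nil => simp [ok, run]
  | cons c u ih => simp only [List.cons_append, ok, run, ih, and_assoc]

lemma step_lt {q0 q1 : ℝ} (h0 : 1 < q0) (h1 : 1 < q1) {d : ℝ × ℝ} (hd : d.1 < d.2) {c : Bool}
    (h : adm q0 q1 d c) : (step q0 q1 d c).1 < (step q0 q1 d c).2 := by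
  cases c
  · simp only [step, adm] at *
    have := lt_min hd h
    gcongr
  · simp only [step, adm] at *
    have := max_lt hd h
    gcongr

lemma run_lt {q0 q1 : ℝ} (h0 : 1 < q0) (h1 : 1 < q1) {d : ℝ × ℝ} (hd : d.1 < d.2) {w : List Bool}
    (h : ok q0 q1 d w) : (run q0 q1 d w).1 < (run q0 q1 d w).2 := by
  induction w generalizing d with
  | nil => exact hd
  | cons c w ih => exact ih (step_lt h0 h1 hd h.1) h.2

lemma fd_step {q0 q1 : ℝ} (h0 : 1 < q0) (h1 : 1 < q1) (d : ℝ × ℝ) :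
    fd q0 q1 false (step q0 q1 d false).1 = d.1 ∧
    fd q0 q1 false (step q0 q1 d false).2 = min d.2 (tt q1) ∧
    fd q0 q1 true (step q0 q1 d true).1 = max d.1 (ss q0 q1) ∧
    fd q0 q1 true (step q0 q1 d true).2 = d.2 := by
  have a : q0 ≠ 0 := by linarith
  have b : q1 ≠ 0 := by linarith
  refine ⟨?_, ?_, ?_, ?_⟩ <;> simp [fd, step, qb, a, b]

lemma fw_mem {q0 q1 : ℝ} (h0 : 1 < q0) (h1 : 1 < q1) (d : ℝ × ℝ) (w : List Bool) :
    d.1 ≤ fw q0 q1 w (run q0 q1 d w).1 ∧ fw q0 q1 w (run q0 q1 d w).2 ≤ d.2 := by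
  induction w generalizing d with
  | nil => exact ⟨le_rfl, le_rfl⟩
  | cons c w ih =>
    obtain ⟨i1, i2⟩ := ih (step q0 q1 d c)
    obtain ⟨s1, s2, s3, s4⟩ := fd_step h0 h1 d
    have j1 := fw_le h0 h1 [c] i1
    have j2 := fw_le h0 h1 [c] i2
    simp only [fw] at j1 j2
    simp only [fw, run]
    cases c
    · rw [s1] at j1; rw [s2] at j2
      exact ⟨j1, j2.trans (min_le_left _ _)⟩
    · rw [s3] at j1; rw [s4] at j2
      exact ⟨(le_max_left _ _).trans j1, j2⟩

lemma fw_strict0 {q0 q1 : ℝ} (h0 : 1 < q0) (h1 : 1 < q1) (d : ℝ × ℝ) (w : List Bool) {y : ℝ}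
    (hy : y < (run q0 q1 d (false :: w)).2) : fw q0 q1 (false :: w) y < tt q1 := by
  have i2 := (fw_mem h0 h1 (step q0 q1 d false) w).2
  have a := (fw_lt h0 h1 w hy).trans_le i2
  have b := fd_lt h0 h1 false a
  rw [(fd_step h0 h1 d).2.1] at b
  exact b.trans_le (min_le_right _ _)

lemma fw_strict1 {q0 q1 : ℝ} (h0 : 1 < q0) (h1 : 1 < q1) (d : ℝ × ℝ) (w : List Bool) {y : ℝ}
    (hy : (run q0 q1 d (true :: w)).1 < y) : ss q0 q1 < fw q0 q1 (true :: w) y := by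
  have i2 := (fw_mem h0 h1 (step q0 q1 d true) w).1
  have a := i2.trans_lt (fw_lt h0 h1 w hy)
  have b := fd_lt h0 h1 true a
  rw [(fd_step h0 h1 d).2.2.1] at b
  exact (le_max_right _ _).trans_lt b

lemma fw_order {q0 q1 : ℝ} (h0 : 1 < q0) (h1 : 1 < q1) (hst : tt q1 ≤ ss q0 q1) (d : ℝ × ℝ)
    (u v : List Bool) (hl : u.length = v.length) (hne : u ≠ v) :
    (∀ y z, y < (run q0 q1 d u).2 → (run q0 q1 d v).1 < z → fw q0 q1 u y < fw q0 q1 v z) ∨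
    (∀ y z, y < (run q0 q1 d v).2 → (run q0 q1 d u).1 < z → fw q0 q1 v y < fw q0 q1 u z) := by
  induction u generalizing v d with
  | nil =>
    cases v with
    | nil => exact absurd rfl hne
    | cons => simp at hl
  | cons c u ih =>
    cases v with
    | nil => simp at hl
    | cons c' v =>
      by_cases hc : c = c'
      · subst hc
        have hne' : u ≠ v := fun h => hne (by rw [h])
        rcases ih (step q0 q1 d c) v (by simpa using hl) hne' with h | h
        · exact Or.inl fun y z hy hz => fd_lt h0 h1 c (h y z hy hz)
        · exact Or.inr fun y z hy hz => fd_lt h0 h1 c (h y z hy hz)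
      · cases c <;> cases c'
        · exact absurd rfl hc
        · exact Or.inl fun y z hy hz =>
            (fw_strict0 h0 h1 d u hy).trans_le (hst.trans (fw_strict1 h0 h1 d v hz).le)
        · exact Or.inr fun y z hy hz =>
            (fw_strict0 h0 h1 d v hy).trans_le (hst.trans (fw_strict1 h0 h1 d u hz).le)
        · exact absurd rfl hc

lemma hs_of_loop {q0 q1 : ℝ} (h0 : 1 < q0) (h1 : 1 < q1) (d : ℝ × ℝ) (w : List Bool)
    (hw : run q0 q1 d w = d) (a b : ℝ) (ha : d.1 < a) (hb : b < d.2)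
    (ha' : a < fw q0 q1 w d.1) (hb' : fw q0 q1 w d.2 < b) : hs q0 q1 a b w := by
  refine ⟨ha'.trans (fw_lt h0 h1 w ha), (fw_lt h0 h1 w hb).trans hb', ?_⟩
  intro r hr
  obtain ⟨p, rfl⟩ := (List.mem_tails _ _).1 hr
  rw [run_append] at hw
  cases r with
  | nil => simp
  | cons c r =>
    cases c
    · refine ⟨fun _ => fw_strict0 h0 h1 (run q0 q1 d p) r (by rw [hw]; exact hb), by simp⟩
    · refine ⟨by simp, fun _ => fw_strict1 h0 h1 (run q0 q1 d p) r (by rw [hw]; exact ha)⟩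

lemma loops_below_aux {q0 q1 : ℝ} (h0 : 1 < q0) (h1 : 1 < q1)
    (d : ℝ × ℝ) (hd : d.1 < d.2) (u v : List Bool) (hl : u.length = v.length) (hne : u ≠ v)
    (hu : run q0 q1 d u = d) (hv : run q0 q1 d v = d)
    (hord : ∀ y z, y < d.2 → d.1 < z → fw q0 q1 u y < fw q0 q1 v z) :
    ∃ q, 1 < q ∧ q < q1 ∧ ¬ (univoque q0 q).Countable := by
  obtain ⟨m, hm1, hm2⟩ := exists_between hd
  have mu := fw_mem h0 h1 d u
  have mv := fw_mem h0 h1 d v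
  rw [hu] at mu
  rw [hv] at mv
  have lov : d.1 < fw q0 q1 v d.1 := by
    have : fw q0 q1 u m ≤ fw q0 q1 v d.1 := by
      refine ge_of_tendsto (((fw_cont_x v).tendsto d.1).mono_left
        (nhdsWithin_le_nhds (s := Set.Ioi d.1))) ?_
      filter_upwards [self_mem_nhdsWithin] with z hz
      exact (hord m z hm2 hz).le
    exact (mu.1.trans_lt (fw_lt h0 h1 u hm1)).trans_le this
  have hiu : fw q0 q1 u d.2 < d.2 := by
    have : fw q0 q1 u d.2 ≤ fw q0 q1 v m := by
      refine le_of_tendsto (((fw_cont_x u).tendsto d.2).mono_left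
        (nhdsWithin_le_nhds (s := Set.Iio d.2))) ?_
      filter_upwards [self_mem_nhdsWithin] with z hz
      exact (hord z m hz hm1).le
    exact this.trans_lt ((fw_lt h0 h1 v hm2).trans_le mv.2)
  have A0 : d.1 < fw q0 q1 (u ++ v) d.1 := by
    rw [fw_append]; exact mu.1.trans_lt (fw_lt h0 h1 u lov)
  have A1 : d.1 < fw q0 q1 (v ++ u) d.1 := by
    rw [fw_append]; exact lov.trans_le (fw_le h0 h1 v mu.1)
  have B0 : fw q0 q1 (u ++ v) d.2 < d.2 := by
    rw [fw_append]; exact (fw_le h0 h1 u mv.2).trans_lt hiu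
  have B1 : fw q0 q1 (v ++ u) d.2 < d.2 := by
    rw [fw_append]; exact (fw_lt h0 h1 v hiu).trans_le mv.2
  obtain ⟨a, ha, ha'⟩ := exists_between (lt_min A0 A1)
  obtain ⟨b, hb, hb'⟩ := exists_between (max_lt B0 B1)
  obtain ⟨ha0, ha1⟩ := lt_min_iff.1 ha'
  obtain ⟨hb0, hb1⟩ := max_lt_iff.1 hb
  refine horseshoe_below h0 h1 a b (u ++ v) (v ++ u) (by simp [add_comm])
    (fun h => hne (List.append_inj h hl).1)
    (hs_of_loop h0 h1 d _ ?_ a b ha hb' ha0 hb0) (hs_of_loop h0 h1 d _ ?_ a b ha hb' ha1 hb1)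
  · rw [run_append, hu, hv]
  · rw [run_append, hv, hu]

lemma loops_below {q0 q1 : ℝ} (h0 : 1 < q0) (h1 : 1 < q1) (hst : tt q1 ≤ ss q0 q1)
    (d : ℝ × ℝ) (hd : d.1 < d.2) (u v : List Bool) (hl : u.length = v.length) (hne : u ≠ v)
    (hu : run q0 q1 d u = d) (hv : run q0 q1 d v = d) :
    ∃ q, 1 < q ∧ q < q1 ∧ ¬ (univoque q0 q).Countable := by
  have := fw_order h0 h1 hst d u v hl hne
  rw [hu, hv] at this
  rcases this with h | h
  · exact loops_below_aux h0 h1 d hd u v hl hne hu hv h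
  · exact loops_below_aux h0 h1 d hd v u hl.symm hne.symm hv hu h

/-- Orbit of a lower endpoint as long as it is not reset. -/
noncomputable def Tlo (q0 q1 : ℝ) (x : ℝ) : ℝ :=
  if x < tt q1 then q0 * x else q1 * max x (ss q0 q1) - 1

/-- Orbit of an upper endpoint as long as it is not reset. -/
noncomputable def Thi (q0 q1 : ℝ) (x : ℝ) : ℝ :=
  if ss q0 q1 < x then q1 * x - 1 else q0 * min x (tt q1)

/-- Itinerary of a lower endpoint. -/
noncomputable def itLo (q0 q1 : ℝ) : ℝ → ℕ → List Bool
  | _, 0 => []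
  | x, n + 1 => (open Classical in decide (¬ x < tt q1)) :: itLo q0 q1 (Tlo q0 q1 x) n

/-- Itinerary of an upper endpoint. -/
noncomputable def itHi (q0 q1 : ℝ) : ℝ → ℕ → List Bool
  | _, 0 => []
  | x, n + 1 => (open Classical in decide (ss q0 q1 < x)) :: itHi q0 q1 (Thi q0 q1 x) n

lemma run_lo {q0 q1 : ℝ} (hst : tt q1 ≤ ss q0 q1) (d : ℝ × ℝ) (w : List Bool)
    (h : ok q0 q1 d w) :
    (∃ j < w.length, (run q0 q1 d w).1 = (Tlo q0 q1)^[j] (q1 * ss q0 q1 - 1)) ∨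
    (w = itLo q0 q1 d.1 w.length ∧ (run q0 q1 d w).1 = (Tlo q0 q1)^[w.length] d.1) := by
  induction w generalizing d with
  | nil => right; exact ⟨rfl, rfl⟩
  | cons c w ih =>
    have IH := ih (step q0 q1 d c) h.2
    have ha := h.1
    by_cases hx : d.1 < tt q1
    · cases c
      · have e : (step q0 q1 d false).1 = Tlo q0 q1 d.1 := by simp [step, Tlo, hx]
        rcases IH with ⟨j, hj, e2⟩ | ⟨e1, e2⟩
        · exact Or.inl ⟨j, by simp; omega, e2⟩
        · right
          rw [e] at e1 e2
          refine ⟨?_, e2⟩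
          rw [List.length_cons, itLo, ← e1]
          simp [hx]
      · have e : (step q0 q1 d true).1 = q1 * ss q0 q1 - 1 := by
          simp [step, max_eq_right (hx.le.trans hst)]
        left
        rcases IH with ⟨j, hj, e2⟩ | ⟨e1, e2⟩
        · exact ⟨j, by simp; omega, e2⟩
        · rw [e] at e2
          exact ⟨w.length, by simp, e2⟩
    · cases c
      · exact absurd ha hx
      · have e : (step q0 q1 d true).1 = Tlo q0 q1 d.1 := by simp [step, Tlo, hx]
        rcases IH with ⟨j, hj, e2⟩ | ⟨e1, e2⟩
        · exact Or.inl ⟨j, by simp; omega, e2⟩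
        · right
          rw [e] at e1 e2
          refine ⟨?_, e2⟩
          rw [List.length_cons, itLo, ← e1]
          simp [not_lt.1 hx]

lemma run_hi {q0 q1 : ℝ} (hst : tt q1 ≤ ss q0 q1) (d : ℝ × ℝ) (w : List Bool)
    (h : ok q0 q1 d w) :
    (∃ j < w.length, (run q0 q1 d w).2 = (Thi q0 q1)^[j] (q0 * tt q1)) ∨
    (w = itHi q0 q1 d.2 w.length ∧ (run q0 q1 d w).2 = (Thi q0 q1)^[w.length] d.2) := by
  induction w generalizing d with
  | nil => right; exact ⟨rfl, rfl⟩
  | cons c w ih =>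
    have IH := ih (step q0 q1 d c) h.2
    have ha := h.1
    by_cases hx : ss q0 q1 < d.2
    · cases c
      · have e : (step q0 q1 d false).2 = q0 * tt q1 := by
          simp [step, min_eq_right (hst.trans hx.le)]
        left
        rcases IH with ⟨j, hj, e2⟩ | ⟨e1, e2⟩
        · exact ⟨j, by simp; omega, e2⟩
        · rw [e] at e2
          exact ⟨w.length, by simp, e2⟩
      · have e : (step q0 q1 d true).2 = Thi q0 q1 d.2 := by simp [step, Thi, hx]
        rcases IH with ⟨j, hj, e2⟩ | ⟨e1, e2⟩
        · exact Or.inl ⟨j, by simp; omega, e2⟩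
        · right
          rw [e] at e1 e2
          refine ⟨?_, e2⟩
          rw [List.length_cons, itHi, ← e1]
          simp [hx]
    · cases c
      · have e : (step q0 q1 d false).2 = Thi q0 q1 d.2 := by simp [step, Thi, hx]
        rcases IH with ⟨j, hj, e2⟩ | ⟨e1, e2⟩
        · exact Or.inl ⟨j, by simp; omega, e2⟩
        · right
          rw [e] at e1 e2
          refine ⟨?_, e2⟩
          rw [List.length_cons, itHi, ← e1]
          simp [not_lt.1 hx]
      · exact absurd ha hx

/-- The finite set of states with both endpoints recently reset. -/
noncomputable def DN (q0 q1 : ℝ) (N : ℕ) : Finset (ℝ × ℝ) :=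
  (Finset.range N).image (fun j => (Tlo q0 q1)^[j] (q1 * ss q0 q1 - 1)) ×ˢ
  (Finset.range N).image (fun j => (Thi q0 q1)^[j] (q0 * tt q1))

lemma window {q0 q1 : ℝ} (hst : tt q1 ≤ ss q0 q1) (d : ℝ × ℝ) (w : List Bool)
    (h : ok q0 q1 d w) (N : ℕ) (hN : w.length ≤ N) (hD : run q0 q1 d w ∉ DN q0 q1 N) :
    w = itLo q0 q1 d.1 w.length ∨ w = itHi q0 q1 d.2 w.length := by
  rcases run_lo hst d w h with ⟨j, hj, e⟩ | ⟨e, -⟩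
  · rcases run_hi hst d w h with ⟨k, hk, e'⟩ | ⟨e', -⟩
    · refine absurd ?_ hD
      rw [DN, Finset.mem_product]
      exact ⟨Finset.mem_image.2 ⟨j, Finset.mem_range.2 (by omega), e.symm⟩,
        Finset.mem_image.2 ⟨k, Finset.mem_range.2 (by omega), e'.symm⟩⟩
    · exact Or.inr e'
  · exact Or.inl e

/-- Admissible words of length `n` from `d` whose intermediate states avoid `F`. -/
def G (q0 q1 : ℝ) (F : Finset (ℝ × ℝ)) (d : ℝ × ℝ) (n : ℕ) (w : List Bool) : Prop :=
  w.length = n ∧ ok q0 q1 d w ∧ ∀ t, 0 < t → t < n → run q0 q1 d (w.take t) ∉ F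

lemma ok_take {q0 q1 : ℝ} {d : ℝ × ℝ} {w : List Bool} (h : ok q0 q1 d w) (t : ℕ) :
    ok q0 q1 d (w.take t) ∧ ok q0 q1 (run q0 q1 d (w.take t)) (w.drop t) := by
  rw [← ok_append, List.take_append_drop]; exact h

lemma run_take_add (q0 q1 : ℝ) (d : ℝ × ℝ) (w : List Bool) (t j : ℕ) :
    run q0 q1 d (w.take (t + j)) = run q0 q1 (run q0 q1 d (w.take t)) ((w.drop t).take j) := by
  rw [← run_append, List.take_add]

lemma base_count {q0 q1 : ℝ} (hst : tt q1 ≤ ss q0 q1) (N : ℕ) (hN : 0 < N) (n : ℕ) :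
    ∀ d : ℝ × ℝ, ∃ S : Finset (List Bool), S.card ≤ 5 * 2 ^ (n / N) ∧
      ∀ w, G q0 q1 (DN q0 q1 N) d n w → w ∈ S := by
  induction n using Nat.strong_induction_on with
  | _ n ih =>
  intro d
  rcases le_or_gt n N with hn | hn
  · refine ⟨{[], itLo q0 q1 d.1 (n-1) ++ [false], itLo q0 q1 d.1 (n-1) ++ [true],
      itHi q0 q1 d.2 (n-1) ++ [false], itHi q0 q1 d.2 (n-1) ++ [true]}, ?_, ?_⟩
    · refine Finset.card_le_five.trans ?_
      have : 0 < 2 ^ (n / N) := by positivity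
      omega
    · rintro w ⟨hl, hok, hF⟩
      rcases List.eq_nil_or_concat w with rfl | ⟨p, c, rfl⟩
      · simp
      · have hpl : p.length = n - 1 := by simp at hl; omega
        have hp : p = itLo q0 q1 d.1 (n-1) ∨ p = itHi q0 q1 d.2 (n-1) := by
          by_cases hp0 : p = []
          · left; subst hp0; simp at hpl; rw [← hpl]; rfl
          · have hpos := List.length_pos_iff.2 hp0
            have h1 := hF p.length hpos (by omega)
            have h2 : (p ++ [c]).take p.length = p := by simp
            rw [List.concat_eq_append, h2] at h1
            rw [List.concat_eq_append, ok_append] at hok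
            have := window hst d p hok.1 N (by omega) h1
            rwa [hpl] at this
        rw [List.concat_eq_append]
        rcases hp with hp | hp <;> rw [hp] <;> cases c <;> simp
  · obtain ⟨S1, c1, m1⟩ := ih (n - N) (by omega) (run q0 q1 d (itLo q0 q1 d.1 N))
    obtain ⟨S2, c2, m2⟩ := ih (n - N) (by omega) (run q0 q1 d (itHi q0 q1 d.2 N))
    refine ⟨S1.image (itLo q0 q1 d.1 N ++ ·) ∪ S2.image (itHi q0 q1 d.2 N ++ ·), ?_, ?_⟩
    · have e : n / N = (n - N) / N + 1 := by
        conv_lhs => rw [show n = (n - N) + N by omega]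
        exact Nat.add_div_right _ hN
      rw [e, pow_succ]
      have a := Finset.card_union_le (S1.image (itLo q0 q1 d.1 N ++ ·))
        (S2.image (itHi q0 q1 d.2 N ++ ·))
      have b1 : (S1.image (itLo q0 q1 d.1 N ++ ·)).card ≤ S1.card := Finset.card_image_le
      have b2 : (S2.image (itHi q0 q1 d.2 N ++ ·)).card ≤ S2.card := Finset.card_image_le
      omega
    · rintro w ⟨hl, hok, hF⟩
      have hlt : (w.take N).length = N := by simp; omega
      have hw := window hst d (w.take N) (ok_take hok N).1 N hlt.le (hF N hN hn)
      rw [hlt] at hw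
      have hG : G q0 q1 (DN q0 q1 N) (run q0 q1 d (w.take N)) (n - N) (w.drop N) := by
        refine ⟨by simp [hl], (ok_take hok N).2, ?_⟩
        intro t ht ht'
        rw [← run_take_add]
        exact hF _ (by omega) (by omega)
      rw [Finset.mem_union, Finset.mem_image, Finset.mem_image]
      rcases hw with hw | hw
      · left
        rw [hw] at hG
        exact ⟨_, m1 _ hG, by rw [← hw]; exact List.take_append_drop _ _⟩
      · right
        rw [hw] at hG
        exact ⟨_, m2 _ hG, by rw [← hw]; exact List.take_append_drop _ _⟩

/-- Counting bound for words whose intermediate states avoid `F`. -/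
def Q (q0 q1 : ℝ) (N : ℕ) (F : Finset (ℝ × ℝ)) : Prop :=
  ∃ C k : ℕ, ∀ d : ℝ × ℝ, d.1 < d.2 → ∀ n : ℕ, ∃ S : Finset (List Bool),
    S.card ≤ C * (n + 1) ^ k * 2 ^ (n / N) ∧ ∀ w, G q0 q1 F d n w → w ∈ S

lemma Q_step {q0 q1 : ℝ} (h0 : 1 < q0) (h1 : 1 < q1)
    (hloop : ∀ d : ℝ × ℝ, d.1 < d.2 → ∀ u v : List Bool, u.length = v.length →
      run q0 q1 d u = d → run q0 q1 d v = d → u = v)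
    (N : ℕ) (F : Finset (ℝ × ℝ)) (d : ℝ × ℝ) (hQ : Q q0 q1 N (insert d F)) : Q q0 q1 N F := by
  classical
  obtain ⟨C, k, hCk⟩ := hQ
  by_cases hd : d.1 < d.2
  swap
  · refine ⟨C, k, fun s hs n => ?_⟩
    obtain ⟨S, hc, hS⟩ := hCk s hs n
    refine ⟨S, hc, fun w hw => hS w ⟨hw.1, hw.2.1, fun t ht ht' hmem => ?_⟩⟩
    rcases Finset.mem_insert.1 hmem with h | h
    · exact hd (h ▸ run_lt h0 h1 hs (ok_take hw.2.1 t).1)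
    · exact hw.2.2 t ht ht' h
  choose! S hcard hS using hCk
  let Z : ℕ → List Bool := fun m =>
    if h : ∃ z : List Bool, z.length = m ∧ run q0 q1 d z = d then h.choose else []
  have hZ : ∀ z : List Bool, run q0 q1 d z = d → Z z.length = z := by
    intro z hz
    have hex : ∃ z' : List Bool, z'.length = z.length ∧ run q0 q1 d z' = d := ⟨z, rfl, hz⟩
    simp only [Z, dif_pos hex]
    exact hloop d hd _ _ hex.choose_spec.1 hex.choose_spec.2 hz
  refine ⟨C + C * C, 2 * k + 2, fun s hs n => ?_⟩
  refine ⟨S s n ∪ (Finset.range (n+1) ×ˢ Finset.range (n+1)).biUnion fun tm =>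
    (S s tm.1 ×ˢ S d (n - tm.1 - tm.2)).image fun pr => pr.1 ++ (Z tm.2 ++ pr.2), ?_, ?_⟩
  · refine (Finset.card_union_le _ _).trans ?_
    have b1 : (S s n).card ≤ C * (n + 1) ^ (2 * k + 2) * 2 ^ (n / N) := by
      refine (hcard s hs n).trans ?_
      gcongr
      · omega
      · omega
    have b2 : ((Finset.range (n+1) ×ˢ Finset.range (n+1)).biUnion fun tm =>
        (S s tm.1 ×ˢ S d (n - tm.1 - tm.2)).image fun pr => pr.1 ++ (Z tm.2 ++ pr.2)).card
        ≤ C * C * (n + 1) ^ (2 * k + 2) * 2 ^ (n / N) := by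
      refine (Finset.card_biUnion_le_card_mul _ _
        (C * C * (n + 1) ^ (2 * k) * 2 ^ (n / N)) ?_).trans ?_
      · rintro ⟨t, m⟩ htm
        simp only [Finset.mem_product, Finset.mem_range] at htm
        refine Finset.card_image_le.trans ?_
        rw [Finset.card_product]
        calc (S s t).card * (S d (n - t - m)).card
            ≤ (C * (t + 1) ^ k * 2 ^ (t / N)) *
              (C * (n - t - m + 1) ^ k * 2 ^ ((n - t - m) / N)) :=
              Nat.mul_le_mul (hcard s hs t) (hcard d hd _)
          _ ≤ (C * (n + 1) ^ k * 2 ^ (t / N)) *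
              (C * (n + 1) ^ k * 2 ^ ((n - t - m) / N)) := by
              gcongr
              · omega
              · omega
          _ = C * C * (n + 1) ^ (2 * k) * 2 ^ (t / N + (n - t - m) / N) := by ring
          _ ≤ _ := by
              gcongr
              · norm_num
              · refine Nat.div_add_div_le_add_div.trans (Nat.div_le_div_right ?_)
                omega
      · rw [Finset.card_product, Finset.card_range]
        apply le_of_eq; ring
    calc _ ≤ _ := Nat.add_le_add b1 b2
      _ = _ := by ring
  · rintro w ⟨hl, hok, hF⟩
    rw [Finset.mem_union]
    let V : Finset ℕ := (Finset.range n).filter fun t => 0 < t ∧ run q0 q1 s (w.take t) = d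
    have hV : ∀ t, t ∈ V ↔ t < n ∧ 0 < t ∧ run q0 q1 s (w.take t) = d := by
      intro t; simp [V]
    by_cases hne : V.Nonempty
    · right
      obtain ⟨t1, t2, t3⟩ := (hV _).1 (V.min'_mem hne)
      obtain ⟨r1, r2, r3⟩ := (hV _).1 (V.max'_mem hne)
      have hle := V.min'_le _ (V.max'_mem hne)
      have hmin : ∀ x, x ∈ V → V.min' hne ≤ x := fun x hx => V.min'_le x hx
      have hmax : ∀ x, x ∈ V → x ≤ V.max' hne := fun x hx => V.le_max' x hx
      generalize V.min' hne = t at *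
      generalize V.max' hne = t' at *
      obtain ⟨m, rfl⟩ := Nat.exists_eq_add_of_le hle
      rw [Finset.mem_biUnion]
      refine ⟨(t, m), ?_, ?_⟩
      · simp; omega
      · rw [Finset.mem_image]
        refine ⟨(w.take t, w.drop (t + m)), ?_, ?_⟩
        · rw [Finset.mem_product]
          constructor
          · apply hS s hs t
            refine ⟨by simp; omega, (ok_take hok t).1, fun x hx hx' hmem => ?_⟩
            rw [List.take_take, min_eq_left hx'.le] at hmem
            rcases Finset.mem_insert.1 hmem with h | h
            · have := hmin x ((hV x).2 ⟨by omega, hx, h⟩); omega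
            · exact hF x hx (by omega) h
          · apply hS d hd (n - t - m)
            refine ⟨by simp; omega, ?_, fun x hx hx' hmem => ?_⟩
            · have := (ok_take hok (t + m)).2
              rwa [r3] at this
            · dsimp only at hmem hx'
              rw [← r3, ← run_take_add] at hmem
              rcases Finset.mem_insert.1 hmem with h | h
              · have := hmax _ ((hV _).2 ⟨by omega, by omega, h.trans r3⟩)
                omega
              · exact hF _ (by omega) (by omega) h
        · have hz : Z m = (w.drop t).take m := by
            have := hZ ((w.drop t).take m) (by rw [← t3, ← run_take_add, r3, t3])
            rwa [show ((w.drop t).take m).length = m by simp; omega] at this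
          dsimp only
          rw [hz, ← List.append_assoc, ← List.take_add, List.take_append_drop]
    · left
      apply hS s hs n
      refine ⟨hl, hok, fun t ht ht' hmem => ?_⟩
      rcases Finset.mem_insert.1 hmem with h | h
      · exact hne ⟨t, (hV t).2 ⟨ht', ht, h⟩⟩
      · exact hF t ht ht' h

lemma count_all {q0 q1 : ℝ} (h0 : 1 < q0) (h1 : 1 < q1) (hst : tt q1 ≤ ss q0 q1)
    (hloop : ∀ d : ℝ × ℝ, d.1 < d.2 → ∀ u v : List Bool, u.length = v.length →
      run q0 q1 d u = d → run q0 q1 d v = d → u = v)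
    (N : ℕ) (hN : 0 < N) : Q q0 q1 N ∅ := by
  have hb : Q q0 q1 N (DN q0 q1 N) := by
    refine ⟨5, 0, fun d _ n => ?_⟩
    simpa using base_count hst N hN n d
  have : ∀ F : Finset (ℝ × ℝ), Q q0 q1 N F → Q q0 q1 N ∅ := by
    classical
    intro F
    induction F using Finset.induction_on with
    | empty => exact id
    | insert a F _ ih => exact fun h => ih (Q_step h0 h1 hloop N F a (by convert h))
  exact this _ hb

/-- Prefix of a sequence. -/
def pre : (ℕ → Bool) → ℕ → List Bool
  | _, 0 => []
  | i, n + 1 => i 0 :: pre (sh i) n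

lemma pre_length (i : ℕ → Bool) (n : ℕ) : (pre i n).length = n := by
  induction n generalizing i with
  | zero => rfl
  | succ n ih => simp [pre, ih]

lemma exists_app_pre (i : ℕ → Bool) (n : ℕ) : ∃ j, i = app (pre i n) j := by
  induction n generalizing i with
  | zero => exact ⟨i, rfl⟩
  | succ n ih =>
    obtain ⟨j, hj⟩ := ih (sh i)
    refine ⟨j, ?_⟩
    rw [pre, app, ← hj, scons_sh]

lemma exists_expansion {q0 q1 : ℝ} (h0 : 1 < q0) (h1 : 1 < q1) (hst : tt q1 ≤ ss q0 q1)
    (x : ℝ) (hx0 : 0 ≤ x) (hx1 : x ≤ 1 / (q1 - 1)) : ∃ i, piE q0 q1 i = x := by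
  classical
  have hq : 0 < q1 - 1 := by linarith
  have hM : 0 < 1 / (q1 - 1) := by positivity
  have hss : q0 * ss q0 q1 = 1 / (q1 - 1) := by unfold ss; field_simp
  have hMM : q1 * (1 / (q1 - 1)) - 1 = 1 / (q1 - 1) := by field_simp; ring
  have htt : q1 * tt q1 = 1 := by unfold tt; field_simp
  let T : ℝ → ℝ := fun y => if y < tt q1 then q0 * y else q1 * y - 1
  have hT : ∀ y, 0 ≤ y ∧ y ≤ 1 / (q1 - 1) → 0 ≤ T y ∧ T y ≤ 1 / (q1 - 1) := by
    rintro y ⟨a, b⟩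
    by_cases hy : y < tt q1
    · simp only [T, if_pos hy]
      refine ⟨by positivity, ?_⟩
      rw [← hss]
      exact mul_le_mul_of_nonneg_left (hy.le.trans hst) (by linarith)
    · simp only [T, if_neg hy]
      have c1 := mul_le_mul_of_nonneg_left (not_lt.1 hy) (by linarith : 0 ≤ q1)
      have c2 := mul_le_mul_of_nonneg_left b (by linarith : 0 ≤ q1)
      constructor <;> linarith
  have hg : ∀ n : ℕ, 0 ≤ T^[n] x ∧ T^[n] x ≤ 1 / (q1 - 1) := by
    intro n
    induction n with
    | zero => exact ⟨hx0, hx1⟩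
    | succ n ih => rw [Function.iterate_succ_apply']; exact hT _ ih
  refine ⟨fun n => decide (¬ T^[n] x < tt q1), ?_⟩
  symm
  refine eq_piE_of_orbit h0 h1 _ (fun n => T^[n] x) (1 / (q1 - 1)) ?_ ?_
  · intro n
    rw [abs_of_nonneg (hg n).1]
    exact (hg n).2
  · intro n
    rw [Function.iterate_succ_apply']
    generalize T^[n] x = y
    have a : q0 ≠ 0 := by linarith
    have b : q1 ≠ 0 := by linarith
    by_cases hy : y < tt q1
    · simp [fd, T, hy, qb, a]
    · simp [fd, T, hy, qb, b]

lemma sep_of_unique {q0 q1 : ℝ} (h0 : 1 < q0) (h1 : 1 < q1) (hst : tt q1 ≤ ss q0 q1)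
    (i : ℕ → Bool) (hi : ∀ j, piE q0 q1 j = piE q0 q1 i → j = i) : sep q0 q1 i := by
  have hq : 0 < q1 - 1 := by linarith
  have hss : q0 * ss q0 q1 = 1 / (q1 - 1) := by unfold ss; field_simp
  have htt : q1 * tt q1 = 1 := by unfold tt; field_simp
  have hMM : q1 * (1 / (q1 - 1)) - 1 = 1 / (q1 - 1) := by field_simp; ring
  have a : q0 ≠ 0 := by linarith
  have b : q1 ≠ 0 := by linarith
  have p0 := piE_nonneg h0 h1 i
  have p1 := piE_le h0 h1 i
  refine ⟨fun hi0 => ?_, fun hi0 => ?_⟩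
  · by_contra hlt
    have c1 := mul_le_mul_of_nonneg_left (not_lt.1 hlt) (by linarith : 0 ≤ q1)
    have c2 := mul_le_mul_of_nonneg_left p1 (by linarith : 0 ≤ q1)
    obtain ⟨j, hj⟩ := exists_expansion h0 h1 hst (q1 * piE q0 q1 i - 1) (by linarith)
      (by linarith)
    have := hi (scons true j) (by rw [piE_scons h0 h1, hj]; simp [fd, qb, b])
    have h' : true = i 0 := congrFun this 0
    rw [hi0] at h'
    exact absurd h' (by simp)
  · by_contra hlt
    have c1 := mul_le_mul_of_nonneg_left (not_lt.1 hlt) (by linarith : 0 ≤ q0)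
    obtain ⟨j, hj⟩ := exists_expansion h0 h1 hst (q0 * piE q0 q1 i) (by positivity)
      (by linarith)
    have := hi (scons false j) (by rw [piE_scons h0 h1, hj]; simp [fd, qb, a])
    have h' : false = i 0 := congrFun this 0
    rw [hi0] at h'
    exact absurd h' (by simp)

lemma ok_pre {q0 q1 : ℝ} (h0 : 1 < q0) (h1 : 1 < q1) (hst : tt q1 ≤ ss q0 q1) (n : ℕ) :
    ∀ (i : ℕ → Bool) (d : ℝ × ℝ), (∀ j, piE q0 q1 j = piE q0 q1 i → j = i) →
    d.1 ≤ piE q0 q1 i → piE q0 q1 i ≤ d.2 → ok q0 q1 d (pre i n) := by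
  induction n with
  | zero => intro i d _ _ _; trivial
  | succ n ih =>
    intro i d hi hd1 hd2
    have hsep := sep_of_unique h0 h1 hst i hi
    have hu : ∀ j, piE q0 q1 j = piE q0 q1 (sh i) → j = sh i := by
      intro j hj
      have := hi (scons (i 0) j) (by rw [piE_scons h0 h1, hj, ← piE_rec h0 h1])
      rw [← this, sh_scons]
    have hrec := piE_rec h0 h1 i
    have a : 0 < q0 := by linarith
    have b : 0 < q1 := by linarith
    rw [pre]
    cases hi0 : i 0
    · have hlt := hsep.1 hi0
      have e : piE q0 q1 (sh i) = q0 * piE q0 q1 i := by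
        rw [hrec, hi0]; simp [fd, qb]; field_simp
      refine ⟨hd1.trans_lt hlt, ih _ _ hu ?_ ?_⟩
      · rw [e]; exact mul_le_mul_of_nonneg_left hd1 a.le
      · rw [e]; exact mul_le_mul_of_nonneg_left (le_min hd2 hlt.le) a.le
    · have hlt := hsep.2 hi0
      have e : piE q0 q1 (sh i) = q1 * piE q0 q1 i - 1 := by
        rw [hrec, hi0]; simp [fd, qb]; field_simp; ring
      refine ⟨hlt.trans_le hd2, ih _ _ hu ?_ ?_⟩
      · rw [e]; exact sub_le_sub_right (mul_le_mul_of_nonneg_left (max_le hd1 hlt.le) b.le) 1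
      · rw [e]; exact sub_le_sub_right (mul_le_mul_of_nonneg_left hd2 b.le) 1

open MeasureTheory in
lemma dim_zero {q0 q1 : ℝ} (h0 : 1 < q0) (h1 : 1 < q1) (hst : tt q1 ≤ ss q0 q1)
    (hloop : ∀ d : ℝ × ℝ, d.1 < d.2 → ∀ u v : List Bool, u.length = v.length →
      run q0 q1 d u = d → run q0 q1 d v = d → u = v) : dimH (univoque q0 q1) = 0 := by
  obtain ⟨ρ, hρ0, hρ1, hρ⟩ := exists_rho h0 h1
  have hq : 0 < q1 - 1 := by linarith
  set M : ℝ := 1 / (q1 - 1) with hM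
  have hMpos : 0 < M := by positivity
  refine le_antisymm ?_ (bot_le)
  refine ENNReal.le_of_forall_pos_le_add fun e he _ => ?_
  rw [zero_add]
  apply dimH_le_of_hausdorffMeasure_ne_top
  have he' : (0 : ℝ) < e := he
  set γ : ℝ := ρ ^ ((e : ℝ) / 2) with hγ
  have hγ0 : 0 < γ := Real.rpow_pos_of_pos hρ0 _
  have hγ1 : γ < 1 := Real.rpow_lt_one hρ0.le hρ1 (by positivity)
  obtain ⟨N', hN'⟩ := exists_pow_lt_of_lt_one (show (0:ℝ) < 1 / 2 by norm_num) hγ1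
  set N := N' + 1 with hN
  have hNγ : γ ^ N ≤ 1 / 2 := (pow_le_pow_of_le_one hγ0.le hγ1.le (Nat.le_succ _)).trans hN'.le
  obtain ⟨C, k, hCk⟩ := count_all h0 h1 hst hloop N (Nat.succ_pos _)
  choose S hcard hS using hCk (0, M) hMpos
  -- the covering
  let tset : ∀ n : ℕ, S n → Set ℝ := fun n w => fw q0 q1 w.1 '' Set.Icc 0 M ∩
    {_x | w.1.length = n}
  have hdiam : ∀ n (w : S n), Metric.ediam (tset n w) ≤ ENNReal.ofReal (ρ ^ n * M) := by
    intro n w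
    apply Metric.ediam_le
    rintro _ ⟨⟨x, hx, rfl⟩, hl⟩ _ ⟨⟨y, hy, rfl⟩, -⟩
    rw [edist_dist, Real.dist_eq]
    apply ENNReal.ofReal_le_ofReal
    have := fw_contr h0 h1 hρ w.1 x y
    rw [show w.1.length = n from hl] at this
    refine this.trans ?_
    have h3 : |x - y| ≤ M := by
      rw [abs_le]; constructor <;> linarith [hx.1, hx.2, hy.1, hy.2]
    gcongr
  have hcov : ∀ n, univoque q0 q1 ⊆ ⋃ w : S n, tset n w := by
    rintro n x ⟨i, rfl, hi⟩
    have hok := ok_pre h0 h1 hst n i (0, M) hi (piE_nonneg h0 h1 i) (piE_le h0 h1 i)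
    have hmem := hS n (pre i n) ⟨pre_length i n, hok, by simp⟩
    obtain ⟨j, hj⟩ := exists_app_pre i n
    rw [Set.mem_iUnion]
    refine ⟨⟨_, hmem⟩, ⟨piE q0 q1 j, ⟨piE_nonneg h0 h1 j, piE_le h0 h1 j⟩, ?_⟩, pre_length i n⟩
    dsimp only
    rw [← piE_app h0 h1, ← hj]
  have hr : Tendsto (fun n : ℕ => ENNReal.ofReal (ρ ^ n * M)) atTop (𝓝 0) := by
    have := (tendsto_pow_atTop_nhds_zero_of_lt_one hρ0.le hρ1).mul_const M
    rw [zero_mul] at this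
    simpa using ENNReal.tendsto_ofReal this
  have key := Measure.hausdorffMeasure_le_liminf_sum (e : ℝ) (univoque q0 q1) _ hr tset
    (Eventually.of_forall hdiam) (Eventually.of_forall hcov)
  have hlim : Tendsto (fun n : ℕ => ∑ w : S n, Metric.ediam (tset n w) ^ (e : ℝ)) atTop (𝓝 0) := by
    have hup : Tendsto (fun n : ℕ => ENNReal.ofReal
        ((C * M ^ (e : ℝ) * γ⁻¹) * (((n + 1 : ℕ) : ℝ) ^ k * γ ^ (n + 1)))) atTop (𝓝 0) := by
      have := ((tendsto_pow_const_mul_const_pow_of_lt_one k hγ0.le hγ1).comp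
        (tendsto_add_atTop_nat 1)).const_mul (C * M ^ (e : ℝ) * γ⁻¹)
      rw [mul_zero] at this
      simpa using ENNReal.tendsto_ofReal this
    refine tendsto_of_tendsto_of_tendsto_of_le_of_le tendsto_const_nhds hup
      (fun _ => bot_le) ?_
    intro n
    have hpow : (ρ ^ n * M) ^ (e : ℝ) = γ ^ n * γ ^ n * M ^ (e : ℝ) := by
      rw [Real.mul_rpow (by positivity) hMpos.le]
      congr 1
      rw [hγ, ← Real.rpow_natCast, ← Real.rpow_natCast, ← Real.rpow_mul hρ0.le,
        ← Real.rpow_mul hρ0.le, ← Real.rpow_add hρ0]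
      congr 1
      ring
    have h2 : (2 : ℝ) ^ (n / N) * γ ^ n ≤ 1 := by
      have : γ ^ n ≤ (γ ^ N) ^ (n / N) := by
        rw [← pow_mul]
        exact pow_le_pow_of_le_one hγ0.le hγ1.le (Nat.mul_div_le _ _)
      calc (2 : ℝ) ^ (n / N) * γ ^ n ≤ 2 ^ (n / N) * (γ ^ N) ^ (n / N) := by gcongr
        _ = (2 * γ ^ N) ^ (n / N) := by rw [mul_pow]
        _ ≤ 1 := pow_le_one₀ (by positivity) (by linarith)
    calc ∑ w : S n, Metric.ediam (tset n w) ^ (e : ℝ)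
        ≤ ∑ _w : S n, ENNReal.ofReal ((ρ ^ n * M) ^ (e : ℝ)) := by
          refine Finset.sum_le_sum fun w _ => ?_
          rw [← ENNReal.ofReal_rpow_of_nonneg (by positivity) he'.le]
          exact ENNReal.rpow_le_rpow (hdiam n w) he'.le
      _ = ENNReal.ofReal ((S n).card * (ρ ^ n * M) ^ (e : ℝ)) := by
          rw [Finset.sum_const, Finset.card_univ, Fintype.card_coe, nsmul_eq_mul,
            ENNReal.ofReal_mul (by positivity), ENNReal.ofReal_natCast]
      _ ≤ _ := by
          apply ENNReal.ofReal_le_ofReal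
          rw [hpow]
          have hc : ((S n).card : ℝ) ≤ C * ((n + 1 : ℕ) : ℝ) ^ k * 2 ^ (n / N) := by
            exact_mod_cast hcard n
          have hMe : 0 < M ^ (e : ℝ) := Real.rpow_pos_of_pos hMpos _
          calc ((S n).card : ℝ) * (γ ^ n * γ ^ n * M ^ (e : ℝ))
              ≤ (C * ((n + 1 : ℕ) : ℝ) ^ k * 2 ^ (n / N)) * (γ ^ n * γ ^ n * M ^ (e : ℝ)) := by
                gcongr
            _ = (C * ((n + 1 : ℕ) : ℝ) ^ k * γ ^ n * M ^ (e : ℝ)) * (2 ^ (n / N) * γ ^ n) := by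
                ring
            _ ≤ (C * ((n + 1 : ℕ) : ℝ) ^ k * γ ^ n * M ^ (e : ℝ)) * 1 := by gcongr
            _ = _ := by rw [pow_succ]; field_simp
  rw [hlim.liminf_eq] at key
  exact (key.trans_lt (by simp)).ne

lemma no_overlap_below {q0 q1 : ℝ} (h0 : 1 < q0) (h1 : 1 < q1) (hst : ss q0 q1 < tt q1) :
    ∃ q, 1 < q ∧ q < q1 ∧ ¬ (univoque q0 q).Countable := by
  have a : 0 < q0 - 1 := by linarith
  have hq : 0 < q1 - 1 := by linarith
  have h2 : q0 / (q0 - 1) < q1 := by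
    unfold ss tt at hst
    rw [div_lt_div_iff₀ (by positivity) (by positivity)] at hst
    rw [div_lt_iff₀ a]
    linarith
  obtain ⟨q, hq1, hq2⟩ := exists_between h2
  have h3 : 1 < q0 / (q0 - 1) := by rw [lt_div_iff₀ a]; linarith
  have h4 : 1 < q := h3.trans hq1
  have h5 : ss q0 q < tt q := by
    have : 0 < q - 1 := by linarith
    unfold ss tt
    rw [div_lt_div_iff₀ (by positivity) (by positivity)]
    rw [div_lt_iff₀ a] at hq1
    linarith
  refine ⟨q, h4, hq2, uncountable_of_sep h0 h4 Set.univ (fun _ _ => trivial) ?_ id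
    (fun _ => trivial) Function.injective_id⟩
  intro i _
  exact ⟨fun h => (piE_zero_le h0 h4 i h).trans_lt h5, fun h => h5.trans_le (piE_one_ge h0 h4 i h)⟩

end DB

/-- Theorem 1(i): if `q₀ > 1` and `1 < q₁ ≤ 𝒦(q₀)`, then `dim_H 𝒰_{q₀,q₁} = 0`. -/
theorem stmt3 (q0 q1 : ℝ) (hq0 : 1 < q0) (hq1 : 1 < q1) (h : q1 ≤ Kconst q0) :
    dimH (univoque q0 q1) = 0 := by
  have hno : ¬ ∃ q, 1 < q ∧ q < q1 ∧ ¬ (univoque q0 q).Countable := by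
    rintro ⟨q, a, b, c⟩
    have : Kconst q0 ≤ q := csInf_le ⟨1, fun x hx => hx.1.le⟩ ⟨a, c⟩
    linarith
  have hst : DB.tt q1 ≤ DB.ss q0 q1 := by
    by_contra hlt
    exact hno (DB.no_overlap_below hq0 hq1 (not_le.1 hlt))
  refine DB.dim_zero hq0 hq1 hst fun d hd u v hl hu hv => ?_
  by_contra hne
  exact hno (DB.loops_below hq0 hq1 hst d hd u v hl hne hu hv)
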